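/- Let c : [ω₂]² → ω₁ be a function with the finite extension property: for every finite set d of ordinals less than ω₂ + ω and every function e : [d]² → ω₁ with e ↾ [d ∩ ω₂]² = c ↾ [d ∩ ω₂]² that introduces no new agreements over c ↾ [d ∩ ω₂]², there exists an injection ι : d → ω₂ with ι equal to the identity on d ∩ ω₂ and c(ι(β), ι(γ)) = e(β, γ) for all distinct β, γ ∈ d. Then c is surjective onto ω₁. -/

import Mathlib

noncomputable def w1 : Ordinal.{0} := (Cardinal.aleph 1).ord
noncomputable def w2 : Ordinal.{0} := (Cardinal.aleph 2).ord

/-- The agreement set of `x` and `y` with respect to the pair-coloring `c`,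
computed within the domain `D`. -/
def agreeSet (c : Ordinal.{0} → Ordinal.{0} → Ordinal.{0}) (D : Set Ordinal.{0}) (x y : Ordinal.{0}) :
    Set Ordinal.{0} :=
  {z | z ∈ D ∧ z ≠ x ∧ z ≠ y ∧ c x z = c y z}

/-- `m` is a monotone map from finite subsets of `θ` to finite subsets of `θ`. -/
def IsMonotoneMap (θ : Ordinal.{0}) (m : Set Ordinal.{0} → Set Ordinal.{0}) : Prop :=
  ∀ a : Set Ordinal.{0}, a.Finite → a ⊆ Set.Iio θ → a ⊆ m a ∧ (m a).Finite ∧ m a ⊆ Set.Iio θ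

/-- The diagonalization principle (⌐). -/
def PrincipleDiag : Prop :=
  ∀ f : Ordinal.{0} → Ordinal.{0} → Ordinal.{0},
    (∀ α < w1, ∀ β < w1, f α β < w1) →
    ∀ F : Set Ordinal.{0}, F.Finite → F ⊆ Set.Iio w1 →
      ∀ m : Set Ordinal.{0} → Set Ordinal.{0}, IsMonotoneMap w1 m →
        ∃ g : Ordinal.{0} → Ordinal.{0},
          (∀ β < w1, g β < w1) ∧
          (∀ β < w1, g β ∉ F) ∧
          ∀ a : Set Ordinal.{0}, a.Finite → a ⊆ Set.Iio w1 →
            ∃ b : Set Ordinal.{0}, b.Finite ∧ a ⊆ b ∧ b ⊆ Set.Iio w1 ∧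
              ∀ α ∈ m b, ∀ β < w1, f α β = g β → β ∈ m b

theorem stmt_8 (c : Ordinal.{0} → Ordinal.{0} → Ordinal.{0})
    (hsymm : ∀ x y, c x y = c y x)
    (hval : ∀ x y, x < w2 → y < w2 → x ≠ y → c x y < w1)
    (hext : ∀ d : Set Ordinal.{0}, d.Finite → d ⊆ Set.Iio (w2 + Ordinal.omega0.{0}) →
      ∀ e : Ordinal.{0} → Ordinal.{0} → Ordinal.{0},
        (∀ x y, e x y = e y x) →
        (∀ x ∈ d, ∀ y ∈ d, x ≠ y → e x y < w1) →
        (∀ x ∈ d, ∀ y ∈ d, x < w2 → y < w2 → x ≠ y → e x y = c x y) →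
        (∀ x ∈ d, ∀ y ∈ d, x < w2 → y < w2 → x ≠ y →
          agreeSet e d x y = agreeSet c (d ∩ Set.Iio w2) x y) →
        ∃ ι : Ordinal.{0} → Ordinal.{0},
          Set.InjOn ι d ∧
          (∀ x ∈ d, ι x < w2) ∧
          (∀ x ∈ d, x < w2 → ι x = x) ∧
          (∀ x ∈ d, ∀ y ∈ d, x ≠ y → c (ι x) (ι y) = e x y)) :
    ∀ ν < w1, ∃ x y, x < w2 ∧ y < w2 ∧ x ≠ y ∧ c x y = ν := by
  intro ν hν
  have h01 : w2 ≠ w2 + 1 := (lt_add_one w2).ne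
  have hnot : ∀ x ∈ ({w2, w2 + 1} : Set Ordinal.{0}), ¬ x < w2 := by
    rintro x (rfl | rfl)
    · exact lt_irrefl _
    · exact not_lt.mpr (lt_add_one w2).le
  obtain ⟨ι, hinj, hlt, -, hc⟩ := hext {w2, w2 + 1} (by simp) (by
      rintro x (rfl | rfl)
      · exact lt_add_of_pos_right _ Ordinal.omega0_pos
      · exact add_lt_add_right Ordinal.one_lt_omega0 _) (fun _ _ => ν)
    (fun _ _ => rfl) (fun _ _ _ _ _ => hν)
    (fun x hx _ _ h => absurd h (hnot x hx))
    (fun x hx _ _ h => absurd h (hnot x hx))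
  have m0 : w2 ∈ ({w2, w2 + 1} : Set Ordinal.{0}) := by simp
  have m1 : w2 + 1 ∈ ({w2, w2 + 1} : Set Ordinal.{0}) := by simp
  exact ⟨ι w2, ι (w2 + 1), hlt _ m0, hlt _ m1, fun h => h01 (hinj m0 m1 h), hc _ m0 _ m1 h01⟩
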